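/- Let H ∈ (0, 1/6), let (Ω,F,P) be a probability space, and let X¹ : ℝ → Ω → ℝ be a centered Gaussian process with covariance C_H and continuous sample paths. Fix t > 0 and set O_n = 3·Σ_{j=0}^{⌊2^{n/2}t⌋−1} ((X¹_{(j+1)2^{−n/2}} + X¹_{j2^{−n/2}})/2)² · (X¹_{(j+1)2^{−n/2}} − X¹_{j2^{−n/2}}), which is the symmetric Riemann sum O_n(f,t) for f(x,y) = x³. Then the sequence of real random variables (O_n)_{n≥1} does not converge in distribution: there is no Borel probability measure μ on ℝ such that the laws of O_n converge weakly to μ. In particular the symmetric integral ∫₀ᵗ ∇f(X_s) d*X_s does not exist, even stably in law. -/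

import Mathlib

open MeasureTheory ProbabilityTheory Filter

noncomputable section

/-- Covariance function of the (two-sided) fractional Brownian motion with Hurst index `H`:
`C_H(t,s) = (|t|^{2H} + |s|^{2H} − |t−s|^{2H})/2`. -/
def covH (H t s : ℝ) : ℝ :=
  (|t| ^ (2 * H) + |s| ^ (2 * H) - |t - s| ^ (2 * H)) / 2

/-- `ρ_H(k) = (1/2)(|k+1|^{2H} + |k−1|^{2H} − 2|k|^{2H})`. -/
def rhoH (H : ℝ) (k : ℤ) : ℝ :=
  (|(k : ℝ) + 1| ^ (2 * H) + |(k : ℝ) - 1| ^ (2 * H) - 2 * |(k : ℝ)| ^ (2 * H)) / 2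

/-- `X` is a centered Gaussian process with covariance function `C` under `P`: every finite
linear combination of values of the process is a centered real Gaussian random variable with
the appropriate variance. -/
def IsCenteredGaussianProcess {Ω : Type*} [MeasurableSpace Ω] (P : Measure Ω)
    (X : ℝ → Ω → ℝ) (C : ℝ → ℝ → ℝ) : Prop :=
  (∀ t, Measurable (X t)) ∧
  ∀ (m : ℕ) (ts : Fin m → ℝ) (c : Fin m → ℝ),
    Measure.map (fun ω => ∑ i, c i * X (ts i) ω) P =
      gaussianReal 0 (Real.toNNReal (∑ i, ∑ j, c i * c j * C (ts i) (ts j)))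

/-- The σ-algebras generated by the two processes `X1` and `X2` are independent under `P`. -/
def IndepProcesses {Ω : Type*} [MeasurableSpace Ω] (P : Measure Ω)
    (X1 X2 : ℝ → Ω → ℝ) : Prop :=
  ProbabilityTheory.Indep
    (⨆ t : ℝ, MeasurableSpace.comap (X1 t) inferInstance)
    (⨆ t : ℝ, MeasurableSpace.comap (X2 t) inferInstance) P

/-- `g` is infinitely differentiable and bounded together with all its derivatives. -/
def CbSmooth {E : Type*} [NormedAddCommGroup E] [NormedSpace ℝ E] (g : E → ℝ) : Prop :=
  (∀ n : ℕ, ContDiff ℝ n g) ∧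
  ∀ k : ℕ, ∃ M : ℝ, ∀ x : E, ‖iteratedFDeriv ℝ k g x‖ ≤ M

/-- `f : ℝ² → ℝ` (in curried form) belongs to `C_b^∞(ℝ²)`. -/
def CbSmooth2 (f : ℝ → ℝ → ℝ) : Prop :=
  CbSmooth fun p : ℝ × ℝ => f p.1 p.2

/-- Partial derivative of `f : ℝ → ℝ → ℝ`, taken `k` times in the first variable and `l` times
in the second variable. -/
def pd (k l : ℕ) (f : ℝ → ℝ → ℝ) (x y : ℝ) : ℝ :=
  iteratedDeriv k (fun u => iteratedDeriv l (fun v => f u v) y) x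

/-- The dyadic point `j·2^{−n/2}`. -/
def dyadicPt (n j : ℕ) : ℝ := (j : ℝ) * (2 : ℝ) ^ (-(n : ℝ) / 2)

/-- The number of dyadic steps `⌊2^{n/2} t⌋`. -/
def nSteps (n : ℕ) (t : ℝ) : ℕ := Nat.floor ((2 : ℝ) ^ ((n : ℝ) / 2) * t)

variable {Ω : Type*}

/-- The increment `X_{(j+1)2^{−n/2}} − X_{j2^{−n/2}}` of the process `X`. -/
def Xincr (X : ℝ → Ω → ℝ) (n j : ℕ) (ω : Ω) : ℝ :=
  X (dyadicPt n (j + 1)) ω - X (dyadicPt n j) ω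

/-- The midpoint evaluation `Δ_{j,n} g(X¹,X²)`. -/
def Xmid (X1 X2 : ℝ → Ω → ℝ) (g : ℝ → ℝ → ℝ) (n j : ℕ) (ω : Ω) : ℝ :=
  g ((X1 (dyadicPt n (j + 1)) ω + X1 (dyadicPt n j) ω) / 2)
    ((X2 (dyadicPt n (j + 1)) ω + X2 (dyadicPt n j) ω) / 2)

open scoped RealInnerProductSpace

lemma norm_sq_sum_smul_eq {E : Type*} [NormedAddCommGroup E] [InnerProductSpace ℝ E]
    {ι κ : Type*} [Fintype ι] [Fintype κ] (b : OrthonormalBasis κ ℝ E) (a : ι → E)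
    (w : ι → ℝ) :
    ‖∑ j, w j • a j‖ ^ 2 = ∑ i, (∑ j, w j * ⟪b i, a j⟫) ^ 2 := by
  rw [← b.sum_sq_inner_right]
  simp [inner_sum, real_inner_smul_right]

lemma sum_norm_sq_sum_smul_eq {E : Type*} [NormedAddCommGroup E] [InnerProductSpace ℝ E]
    {ι κ : Type*} [Fintype ι] [Fintype κ] (a : ι → E) (w : κ → ι → ℝ) :
    ∑ i, ‖∑ j, w i j • a j‖ ^ 2 = ∑ j, ∑ k, (∑ i, w i j * w i k) * ⟪a j, a k⟫ := by
  simp only [← real_inner_self_eq_norm_sq, sum_inner, inner_sum, real_inner_smul_left,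
    real_inner_smul_right, Finset.sum_mul]
  rw [Finset.sum_comm]
  refine Finset.sum_congr rfl fun j _ => ?_
  rw [Finset.sum_comm]
  refine Finset.sum_congr rfl fun k _ => Finset.sum_congr rfl fun i _ => ?_
  rw [real_inner_comm (a k)]
  ring

section GaussianForms

variable {E : Type*} [NormedAddCommGroup E] [InnerProductSpace ℝ E] [FiniteDimensional ℝ E]
  [MeasurableSpace E] [BorelSpace E] {ι : Type*} [Fintype ι]

lemma map_inner_stdGaussian (v : E) :
    (stdGaussian E).map (fun z => ⟪v, z⟫) = gaussianReal 0 (‖v‖₊ ^ 2) := by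
  refine Measure.ext_of_charFun (funext fun t => ?_)
  rw [charFun_apply, integral_map (by fun_prop) (by fun_prop), charFun_gaussianReal]
  have h := charFun_stdGaussian (t • v)
  rw [charFun_apply] at h
  convert h using 3
  · simp only [real_inner_smul_right, real_inner_comm v, RCLike.inner_apply, conj_trivial]
  · simp only [norm_smul, NNReal.coe_pow, coe_nnnorm]
    push_cast
    have : ((‖t‖ : ℝ) : ℂ) ^ 2 = (t : ℂ) ^ 2 := by
      norm_cast
      simp
    rw [mul_pow, this]
    ring

lemma integral_cos_inner_stdGaussian (v : E) :
    ∫ z, Real.cos ⟪v, z⟫ ∂(stdGaussian E) = Real.exp (-(‖v‖ ^ 2 / 2)) := by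
  have h := congrArg Complex.re (charFun_stdGaussian v)
  rw [charFun_apply, ← RCLike.re_eq_complex_re, ← integral_re] at h
  · rw [show (-(‖v‖ : ℂ) ^ 2 / 2) = ((-(‖v‖ ^ 2 / 2) : ℝ) : ℂ) by push_cast; ring,
      RCLike.re_eq_complex_re, Complex.exp_ofReal_re] at h
    simpa [Complex.exp_ofReal_mul_I_re, Complex.exp_ofReal_re, real_inner_comm v] using h
  · refine Integrable.of_bound (by fun_prop) 1 (Eventually.of_forall fun x => ?_)
    simp [Complex.norm_exp_ofReal_mul_I]

lemma integrable_exp_neg_of_nonneg {α : Type*} [MeasurableSpace α] {μ : Measure α}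
    [IsFiniteMeasure μ] {f : α → ℝ} (hf : Measurable f) (h0 : ∀ x, 0 ≤ f x) :
    Integrable (fun x => Real.exp (-f x)) μ := by
  refine Integrable.of_bound (by fun_prop) 1 (Eventually.of_forall fun x => ?_)
  rw [Real.norm_eq_abs, Real.abs_exp, Real.exp_le_one_iff]
  linarith [h0 x]

lemma integrable_cos_comp {α : Type*} [MeasurableSpace α] {μ : Measure α}
    [IsFiniteMeasure μ] {f : α → ℝ} (hf : Measurable f) :
    Integrable (fun x => Real.cos (f x)) μ :=
  Integrable.of_bound (by fun_prop) 1 (Eventually.of_forall fun x => Real.abs_cos_le_one _)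

/-- Among the Gaussian sums of squares with a given mean, the Laplace transform is largest when
the sum has a single term. -/
lemma integral_exp_neg_sum_sq_le {κ : Type*} [Fintype κ] (l : κ → E) {c : ℝ} (hc : 0 ≤ c) :
    ∫ y, Real.exp (-(c * ∑ i, ⟪l i, y⟫ ^ 2)) ∂(stdGaussian E) ≤
      ∫ h, Real.exp (-(c * ((∑ i, ‖l i‖ ^ 2) * h ^ 2))) ∂(gaussianReal 0 1) := by
  set S := ∑ i, ‖l i‖ ^ 2 with hS
  have hS0 : 0 ≤ S := by positivity
  rcases hS0.eq_or_lt with h0 | hpos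
  · have hl : ∀ i, l i = 0 := fun i => by
      have := (Finset.sum_eq_zero_iff_of_nonneg fun i _ => by positivity).1 h0.symm i
        (Finset.mem_univ i)
      simpa using this
    simp [hl, ← h0]
  have hw : ∑ i, ‖l i‖ ^ 2 / S = 1 := by
    rw [← Finset.sum_div, ← hS, div_self hpos.ne']
  set e : κ → E := fun i => ‖l i‖⁻¹ • l i with he
  have hle : ∀ i y, ⟪l i, y⟫ ^ 2 = ‖l i‖ ^ 2 / S * (S * ⟪e i, y⟫ ^ 2) := by
    intro i y
    rcases eq_or_ne (l i) 0 with h | h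
    · simp [h]
    · have : ‖l i‖ ≠ 0 := by simpa using h
      simp only [he, real_inner_smul_left]
      field_simp
  have hpt : ∀ y, Real.exp (-(c * ∑ i, ⟪l i, y⟫ ^ 2)) ≤
      ∑ i, ‖l i‖ ^ 2 / S * Real.exp (-(c * (S * ⟪e i, y⟫ ^ 2))) := by
    intro y
    have := convexOn_exp.map_sum_le (t := Finset.univ) (w := fun i => ‖l i‖ ^ 2 / S)
      (p := fun i => -(c * (S * ⟪e i, y⟫ ^ 2))) (fun i _ => by positivity) hw
      (fun i _ => Set.mem_univ _)
    simp only [smul_eq_mul] at this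
    refine le_of_eq_of_le (congrArg Real.exp ?_) this
    simp_rw [hle, Finset.mul_sum, ← Finset.sum_neg_distrib]
    exact Finset.sum_congr rfl fun i _ => by ring
  have hint : ∀ i, Integrable (fun y => Real.exp (-(c * (S * ⟪e i, y⟫ ^ 2)))) (stdGaussian E) :=
    fun i => integrable_exp_neg_of_nonneg (by fun_prop) fun y => by positivity
  calc _ ≤ ∫ y, ∑ i, ‖l i‖ ^ 2 / S * Real.exp (-(c * (S * ⟪e i, y⟫ ^ 2))) ∂(stdGaussian E) := by
        refine integral_mono (integrable_exp_neg_of_nonneg (by fun_prop) fun y => by positivity)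
          (integrable_finsetSum _ fun i _ => (hint i).const_mul _) hpt
    _ = ∑ i, ‖l i‖ ^ 2 / S * ∫ h, Real.exp (-(c * (S * h ^ 2))) ∂(gaussianReal 0 1) := by
        rw [integral_finsetSum _ fun i _ => (hint i).const_mul _]
        refine Finset.sum_congr rfl fun i _ => ?_
        rw [integral_const_mul]
        rcases eq_or_ne (l i) 0 with h | h
        · simp [h]
        have h1 : ‖e i‖₊ ^ 2 = 1 := by
          have : ‖e i‖₊ = 1 := by
            ext
            simp [he, norm_smul, h]
          simp [this]
        rw [← h1, ← map_inner_stdGaussian, integral_map (by fun_prop) (by fun_prop)]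
    _ = _ := by rw [← Finset.sum_mul, hw, one_mul]

/-- The symmetric trilinear form polarizing `x ↦ ∑ j, ⟪a j, x⟫ ^ 3`. -/
def cubicForm (a : ι → E) (x y z : E) : ℝ := ∑ j, ⟪a j, x⟫ * ⟪a j, y⟫ * ⟪a j, z⟫

@[fun_prop]
lemma measurable_cubicForm {α : Type*} [MeasurableSpace α] (a : ι → E) {f g h : α → E}
    (hf : Measurable f) (hg : Measurable g) (hh : Measurable h) :
    Measurable fun p => cubicForm a (f p) (g p) (h p) := by
  unfold cubicForm
  fun_prop

lemma integral_cos_cubicForm_le (a : ι → E) (u : ℝ) :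
    ∫ x, ∫ y, ∫ z, Real.cos (u * cubicForm a x y z) ∂(stdGaussian E) ∂(stdGaussian E)
        ∂(stdGaussian E) ≤
      ∫ h, ∫ g, Real.exp (-(u ^ 2 / 2 * h ^ 2 * ((∑ j, ∑ k, ⟪a j, a k⟫ ^ 3) * g ^ 2)))
        ∂(gaussianReal 0 1) ∂(gaussianReal 0 1) := by
  set b := stdOrthonormalBasis ℝ E
  have hbb : ∀ x y : E, ∑ i, ⟪b i, x⟫ * ⟪b i, y⟫ = ⟪x, y⟫ := fun x y => by
    simp_rw [← b.sum_inner_mul_inner x y, real_inner_comm x]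
  have hz : ∀ x y, ∫ z, Real.cos (u * cubicForm a x y z) ∂(stdGaussian E) =
      Real.exp (-(u ^ 2 / 2 * ∑ i, ⟪∑ j, (⟪b i, a j⟫ * ⟪a j, x⟫) • a j, y⟫ ^ 2)) := by
    intro x y
    have h1 : ∀ z, u * cubicForm a x y z = ⟪u • ∑ j, (⟪a j, x⟫ * ⟪a j, y⟫) • a j, z⟫ := by
      intro z
      simp only [cubicForm, real_inner_smul_left, sum_inner]
    simp_rw [h1]
    rw [integral_cos_inner_stdGaussian, norm_smul, mul_pow, norm_sq_sum_smul_eq b]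
    simp only [Real.norm_eq_abs, sq_abs, sum_inner, real_inner_smul_left]
    congr 2
    rw [mul_div_right_comm]
    congr 2 with i
    congr 1
    exact Finset.sum_congr rfl fun j _ => by ring
  have hy : ∀ x, ∫ y, ∫ z, Real.cos (u * cubicForm a x y z) ∂(stdGaussian E) ∂(stdGaussian E) ≤
      ∫ h, Real.exp (-(u ^ 2 / 2 * h ^ 2 *
        ∑ p : Fin (Module.finrank ℝ E) × Fin (Module.finrank ℝ E),
          ⟪∑ j, (⟪b p.1, a j⟫ * ⟪b p.2, a j⟫) • a j, x⟫ ^ 2)) ∂(gaussianReal 0 1) := by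
    intro x
    simp_rw [hz]
    refine (integral_exp_neg_sum_sq_le _ (by positivity)).trans_eq ?_
    simp_rw [norm_sq_sum_smul_eq b, Fintype.sum_prod_type, sum_inner, real_inner_smul_left]
    refine integral_congr_ae (Eventually.of_forall fun h => ?_)
    simp only
    rw [mul_comm (∑ i, _) (h ^ 2), ← mul_assoc]
    congr 4 with i
    refine Finset.sum_congr rfl fun m _ => ?_
    congr 1
    exact Finset.sum_congr rfl fun j _ => by ring
  have hS : ∑ p : Fin (Module.finrank ℝ E) × Fin (Module.finrank ℝ E),
      ‖∑ j, (⟪b p.1, a j⟫ * ⟪b p.2, a j⟫) • a j‖ ^ 2 = ∑ j, ∑ k, ⟪a j, a k⟫ ^ 3 := by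
    rw [sum_norm_sq_sum_smul_eq]
    refine Finset.sum_congr rfl fun j _ => Finset.sum_congr rfl fun k _ => ?_
    rw [pow_succ, sq]
    congr 1
    rw [← hbb (a j) (a k), Finset.sum_mul_sum, Fintype.sum_prod_type]
    exact Finset.sum_congr rfl fun i _ => Finset.sum_congr rfl fun m _ => by ring
  have hint : Integrable (Function.uncurry fun (x : E) (h : ℝ) => Real.exp (-(u ^ 2 / 2 * h ^ 2 *
        ∑ p : Fin (Module.finrank ℝ E) × Fin (Module.finrank ℝ E),
          ⟪∑ j, (⟪b p.1, a j⟫ * ⟪b p.2, a j⟫) • a j, x⟫ ^ 2)))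
      ((stdGaussian E).prod (gaussianReal 0 1)) :=
    integrable_exp_neg_of_nonneg (f := fun q : E × ℝ => u ^ 2 / 2 * q.2 ^ 2 *
        ∑ p : Fin (Module.finrank ℝ E) × Fin (Module.finrank ℝ E),
          ⟪∑ j, (⟪b p.1, a j⟫ * ⟪b p.2, a j⟫) • a j, q.1⟫ ^ 2)
      (by fun_prop) fun q => by positivity
  calc _ ≤ ∫ x, ∫ h, Real.exp (-(u ^ 2 / 2 * h ^ 2 *
        ∑ p : Fin (Module.finrank ℝ E) × Fin (Module.finrank ℝ E),
          ⟪∑ j, (⟪b p.1, a j⟫ * ⟪b p.2, a j⟫) • a j, x⟫ ^ 2)) ∂(gaussianReal 0 1)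
          ∂(stdGaussian E) := by
        refine integral_mono ?_ hint.integral_prod_left hy
        have : Integrable (fun p : E × E × E => Real.cos (u * cubicForm a p.1 p.2.1 p.2.2))
          ((stdGaussian E).prod ((stdGaussian E).prod (stdGaussian E))) :=
          integrable_cos_comp (by fun_prop)
        refine this.integral_prod_left.congr ?_
        filter_upwards [] with x
        exact integral_prod _ (integrable_cos_comp (by fun_prop))
    _ = ∫ h, ∫ x, Real.exp (-(u ^ 2 / 2 * h ^ 2 *
        ∑ p : Fin (Module.finrank ℝ E) × Fin (Module.finrank ℝ E),
          ⟪∑ j, (⟪b p.1, a j⟫ * ⟪b p.2, a j⟫) • a j, x⟫ ^ 2)) ∂(stdGaussian E)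
          ∂(gaussianReal 0 1) := integral_integral_swap hint
    _ ≤ _ := by
        refine integral_mono hint.swap.integral_prod_left ?_ fun h => ?_
        · have : Integrable (fun q : ℝ × ℝ => Real.exp (-(u ^ 2 / 2 * q.1 ^ 2 *
              ((∑ j, ∑ k, ⟪a j, a k⟫ ^ 3) * q.2 ^ 2))))
              ((gaussianReal 0 1).prod (gaussianReal 0 1)) := by
            rw [← hS]
            exact integrable_exp_neg_of_nonneg (by fun_prop) fun q => by positivity
          exact this.integral_prod_left
        · rw [← hS]
          exact integral_exp_neg_sum_sq_le _ (by positivity)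

lemma tendsto_integral_exp_neg_sq_mul_sq {u : ℝ} (hu : 0 < u) :
    Tendsto (fun S : ℝ => ∫ h, ∫ g, Real.exp (-(u ^ 2 / 2 * h ^ 2 * (S * g ^ 2)))
        ∂(gaussianReal 0 1) ∂(gaussianReal 0 1)) atTop (nhds 0) := by
  have hne : ∀ᵐ x ∂(gaussianReal 0 1), x ≠ 0 := by
    have : NullSingletonClass (gaussianReal 0 1) :=
      nullSingletonClass_gaussianReal one_ne_zero
    simp [ae_iff, measure_singleton]
  have hb : ∀ S : ℝ, 0 ≤ S → ∀ g h : ℝ, ‖Real.exp (-(u ^ 2 / 2 * h ^ 2 * (S * g ^ 2)))‖ ≤ 1 := by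
    intro S hS g h
    rw [Real.norm_eq_abs, Real.abs_exp, Real.exp_le_one_iff, neg_nonpos]
    positivity
  have h1 : ∀ h : ℝ, h ≠ 0 → Tendsto (fun S : ℝ => ∫ g, Real.exp (-(u ^ 2 / 2 * h ^ 2 *
      (S * g ^ 2))) ∂(gaussianReal 0 1)) atTop (nhds 0) := by
    intro h hh
    refine Tendsto.mono_right (y := nhds (∫ _, (0 : ℝ) ∂(gaussianReal 0 1)))
      (tendsto_integral_filter_of_dominated_convergence (fun _ => 1)
      (Eventually.of_forall fun S => by fun_prop) ?_ (integrable_const _) ?_) (by simp)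
    · filter_upwards [eventually_ge_atTop 0] with S hS
      exact Eventually.of_forall fun g => hb S hS g h
    · filter_upwards [hne] with g hg
      refine Real.tendsto_exp_atBot.comp (tendsto_neg_atTop_atBot.comp ?_)
      refine Tendsto.const_mul_atTop (by positivity) ?_
      exact tendsto_id.atTop_mul_const (by positivity)
  refine Tendsto.mono_right (y := nhds (∫ _, (0 : ℝ) ∂(gaussianReal 0 1)))
      (tendsto_integral_filter_of_dominated_convergence (fun _ => 1)
    (Eventually.of_forall fun S => ?_) ?_ (integrable_const _) ?_) (by simp)
  · refine (StronglyMeasurable.integral_prod_right (f := fun h g : ℝ =>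
      Real.exp (-(u ^ 2 / 2 * h ^ 2 * (S * g ^ 2)))) ?_).aestronglyMeasurable
    exact Measurable.stronglyMeasurable (by fun_prop)
  · filter_upwards [eventually_ge_atTop 0] with S hS
    refine Eventually.of_forall fun h => ?_
    exact (norm_integral_le_of_norm_le_const (C := 1)
      (Eventually.of_forall fun g => hb S hS g h)).trans (by simp)
  · filter_upwards [hne] with h hh using h1 h hh

lemma map_smul_add_stdGaussian {α β δ : ℝ} (h : α ^ 2 + β ^ 2 + δ ^ 2 = 1) :
    ((stdGaussian E).prod ((stdGaussian E).prod (stdGaussian E))).map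
      (fun p => α • p.1 + β • p.2.1 + δ • p.2.2) = stdGaussian E := by
  refine Measure.ext_of_charFun (funext fun t => ?_)
  have hc : ∀ r : ℝ, ∫ x, Complex.exp ((r * ⟪x, t⟫ : ℝ) * Complex.I) ∂(stdGaussian E) =
      Complex.exp (-(r ^ 2 * ‖t‖ ^ 2 / 2 : ℝ)) := by
    intro r
    have h := charFun_stdGaussian (r • t)
    simp only [charFun_apply, real_inner_smul_right] at h
    rw [h, norm_smul]
    congr 1
    norm_cast
    rw [mul_pow, Real.norm_eq_abs, sq_abs]
    ring
  rw [charFun_apply, integral_map (by fun_prop) (by fun_prop), charFun_stdGaussian]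
  have he : ∀ p : E × E × E,
      Complex.exp ((⟪α • p.1 + β • p.2.1 + δ • p.2.2, t⟫ : ℝ) * Complex.I) =
      Complex.exp ((α * ⟪p.1, t⟫ : ℝ) * Complex.I) *
        (Complex.exp ((β * ⟪p.2.1, t⟫ : ℝ) * Complex.I) *
          Complex.exp ((δ * ⟪p.2.2, t⟫ : ℝ) * Complex.I)) := by
    intro p
    simp only [inner_add_left, real_inner_smul_left, ← Complex.exp_add]
    congr 1
    push_cast
    ring
  simp_rw [he]
  rw [integral_prod_mul (fun x : E => Complex.exp ((α * ⟪x, t⟫ : ℝ) * Complex.I))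
      (fun q : E × E => Complex.exp ((β * ⟪q.1, t⟫ : ℝ) * Complex.I) *
          Complex.exp ((δ * ⟪q.2, t⟫ : ℝ) * Complex.I)),
    integral_prod_mul (fun x : E => Complex.exp ((β * ⟪x, t⟫ : ℝ) * Complex.I))
      (fun x : E => Complex.exp ((δ * ⟪x, t⟫ : ℝ) * Complex.I)), hc, hc, hc,
    ← Complex.exp_add, ← Complex.exp_add]
  congr 1
  norm_cast
  linear_combination (-‖t‖ ^ 2 / 2) * h

lemma one_sub_cos_add_le (a b : ℝ) :
    1 - Real.cos (a + b) ≤ 2 * (1 - Real.cos a) + 2 * (1 - Real.cos b) := by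
  have h1 := Real.sin_sq_add_cos_sq a
  have h2 := Real.sin_sq_add_cos_sq b
  rw [Real.cos_add]
  nlinarith [sq_nonneg (Real.sin a - Real.sin b), sq_nonneg (Real.cos a + Real.cos b - 2),
    Real.cos_le_one a, Real.cos_le_one b]

/-- Polarization bound: the characteristic function of the trilinear form evaluated at three
independent Gaussian vectors is controlled by that of the cubic form. -/
lemma one_sub_integral_cos_cubicForm_le (a : ι → E) (s : ℝ) :
    1 - ∫ x, ∫ y, ∫ z, Real.cos (8 / √3 * s * cubicForm a x y z) ∂(stdGaussian E)
        ∂(stdGaussian E) ∂(stdGaussian E) ≤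
      16 * (1 - ∫ x, Real.cos (s * cubicForm a x x x) ∂(stdGaussian E)) := by
  set γ := (stdGaussian E).prod ((stdGaussian E).prod (stdGaussian E)) with hγ
  have h3 : (√3 : ℝ) ^ 2 = 3 := Real.sq_sqrt (by norm_num)
  have h30 : (√3 : ℝ) ≠ 0 := by positivity
  have key : ∀ β δ : ℝ, β ^ 2 = 1 → δ ^ 2 = 1 →
      ∫ x, Real.cos (s * cubicForm a x x x) ∂(stdGaussian E) =
      ∫ p, Real.cos (s / (√3) ^ 3 * cubicForm a (p.1 + β • p.2.1 + δ • p.2.2)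
        (p.1 + β • p.2.1 + δ • p.2.2) (p.1 + β • p.2.1 + δ • p.2.2)) ∂γ := by
    intro β δ hβ hδ
    rw [← map_smul_add_stdGaussian (E := E) (α := (√3)⁻¹) (β := (√3)⁻¹ * β) (δ := (√3)⁻¹ * δ)
      (by rw [mul_pow, mul_pow, hβ, hδ, inv_pow, h3]; norm_num),
      integral_map (by fun_prop) (Measurable.aestronglyMeasurable (by fun_prop))]
    refine integral_congr_ae (Eventually.of_forall fun p => ?_)
    simp only [mul_smul, ← smul_add]
    congr 1
    simp only [cubicForm, real_inner_smul_right, Finset.mul_sum]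
    refine Finset.sum_congr rfl fun j _ => ?_
    field_simp
  set w : ℝ → ℝ → E × E × E → ℝ := fun β δ p =>
    1 - Real.cos (s / (√3) ^ 3 * cubicForm a (p.1 + β • p.2.1 + δ • p.2.2)
        (p.1 + β • p.2.1 + δ • p.2.2) (p.1 + β • p.2.1 + δ • p.2.2)) with hw
  have hcos : ∀ β δ : ℝ, Integrable (fun p : E × E × E =>
      Real.cos (s / (√3) ^ 3 * cubicForm a (p.1 + β • p.2.1 + δ • p.2.2)
        (p.1 + β • p.2.1 + δ • p.2.2) (p.1 + β • p.2.1 + δ • p.2.2))) γ :=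
    fun β δ => integrable_cos_comp (by fun_prop)
  have hint : ∀ β δ : ℝ, Integrable (w β δ) γ := fun β δ => (integrable_const _).sub (hcos β δ)
  have htri : Integrable (fun p : E × E × E =>
      Real.cos (8 / √3 * s * cubicForm a p.1 p.2.1 p.2.2)) γ := integrable_cos_comp (by fun_prop)
  have hl : ∫ x, ∫ y, ∫ z, Real.cos (8 / √3 * s * cubicForm a x y z) ∂(stdGaussian E)
        ∂(stdGaussian E) ∂(stdGaussian E) =
      ∫ p, Real.cos (8 / √3 * s * cubicForm a p.1 p.2.1 p.2.2) ∂γ := by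
    rw [hγ, integral_prod _ htri]
    refine integral_congr_ae (Eventually.of_forall fun x => ?_)
    exact (integral_prod (fun q : E × E => Real.cos (8 / √3 * s * cubicForm a x q.1 q.2))
      (integrable_cos_comp (by fun_prop))).symm
  have hone : ∀ f : E × E × E → ℝ, Integrable f γ → ∫ p, (1 - f p) ∂γ = 1 - ∫ p, f p ∂γ := by
    intro f hf
    rw [integral_sub (integrable_const _) hf]
    simp
  have hval : ∀ β δ : ℝ, β ^ 2 = 1 → δ ^ 2 = 1 →
      ∫ p, w β δ p ∂γ = 1 - ∫ x, Real.cos (s * cubicForm a x x x) ∂(stdGaussian E) := by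
    intro β δ hβ hδ
    rw [key β δ hβ hδ, ← hone _ (hcos β δ)]
  have hpt : ∀ p : E × E × E, 1 - Real.cos (8 / √3 * s * cubicForm a p.1 p.2.1 p.2.2) ≤
      4 * (w 1 1 p + w 1 (-1) p + w (-1) 1 p + w (-1) (-1) p) := by
    intro p
    set r := s / (√3) ^ 3
    set v : ℝ → ℝ → ℝ := fun β δ => r * cubicForm a (p.1 + β • p.2.1 + δ • p.2.2)
        (p.1 + β • p.2.1 + δ • p.2.2) (p.1 + β • p.2.1 + δ • p.2.2) with hv
    have hid : 8 / √3 * s * cubicForm a p.1 p.2.1 p.2.2 =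
        (v 1 1 + -v 1 (-1)) + (-v (-1) 1 + v (-1) (-1)) := by
      have hr : 8 / √3 * s = 24 * r := by
        simp only [r]
        field_simp
        rw [h3]
        ring
      rw [hr]
      simp only [hv, cubicForm, Finset.mul_sum, ← Finset.sum_add_distrib, ← Finset.sum_neg_distrib]
      refine Finset.sum_congr rfl fun j _ => ?_
      simp only [inner_add_right, real_inner_smul_right]
      ring
    have e1 := one_sub_cos_add_le (v 1 1 + -v 1 (-1)) (-v (-1) 1 + v (-1) (-1))
    have e2 := one_sub_cos_add_le (v 1 1) (-v 1 (-1))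
    have e3 := one_sub_cos_add_le (-v (-1) 1) (v (-1) (-1))
    rw [Real.cos_neg] at e2 e3
    rw [hid]
    simp only [hw]
    simp only [hv] at *
    linarith
  have hint₂ : Integrable (fun p => w 1 1 p + w 1 (-1) p) γ := (hint 1 1).add (hint 1 (-1))
  have hint₃ : Integrable (fun p => w 1 1 p + w 1 (-1) p + w (-1) 1 p) γ :=
    hint₂.add (hint (-1) 1)
  have hint₄ : Integrable (fun p => w 1 1 p + w 1 (-1) p + w (-1) 1 p + w (-1) (-1) p) γ :=
    hint₃.add (hint (-1) (-1))
  have hmono := integral_mono ((integrable_const 1).sub htri) (hint₄.const_mul 4) hpt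
  simp only [Pi.sub_apply] at hmono
  rw [hone _ htri, integral_const_mul,
    integral_add hint₃ (hint (-1) (-1)), integral_add hint₂ (hint (-1) 1),
    integral_add (hint 1 1) (hint 1 (-1)), hval 1 1 (by norm_num) (by norm_num),
    hval 1 (-1) (by norm_num) (by norm_num), hval (-1) 1 (by norm_num) (by norm_num),
    hval (-1) (-1) (by norm_num) (by norm_num)] at hmono
  rw [hl]
  linarith

end GaussianForms

/-- A centered Gaussian vector is the image of a standard Gaussian vector under the pairing with
vectors whose Gram matrix is its covariance matrix. -/
lemma exists_gram_map_eq_map_stdGaussian {Ω ι : Type*} [MeasurableSpace Ω] [Fintype ι]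
    {P : Measure Ω} [IsProbabilityMeasure P]
    {Y : ι → Ω → ℝ} (hYm : ∀ j, Measurable (Y j)) {R : Matrix ι ι ℝ} (hR : R.PosSemidef)
    (hY : ∀ c : ι → ℝ, P.map (fun ω => ∑ j, c j * Y j ω) =
      gaussianReal 0 (Real.toNNReal (∑ i, ∑ j, c i * c j * R i j))) :
    ∃ (m : ℕ) (a : ι → EuclideanSpace ℝ (Fin m)), (∀ j k, ⟪a j, a k⟫ = R j k) ∧
      P.map (fun ω => WithLp.toLp 2 fun j => Y j ω) =
        (stdGaussian (EuclideanSpace ℝ (Fin m))).map (fun x => WithLp.toLp 2 fun j => ⟪a j, x⟫) := by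
  obtain ⟨m, v, hv⟩ := Matrix.posSemidef_iff_eq_sum_vecMulVec.1 hR
  set a : ι → EuclideanSpace ℝ (Fin m) := fun j => WithLp.toLp 2 fun i => v i j with ha
  have hgram : ∀ j k, ⟪a j, a k⟫ = R j k := by
    intro j k
    simp [ha, hv, Matrix.sum_apply, Matrix.vecMulVec_apply, PiLp.inner_apply, mul_comm]
  refine ⟨m, a, hgram, ?_⟩
  refine Measure.ext_of_charFun (funext fun c => ?_)
  have hnorm : ∑ i, ∑ j, c i * c j * R i j = ‖∑ j, c j • a j‖ ^ 2 := by
    rw [← real_inner_self_eq_norm_sq, sum_inner]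
    refine Finset.sum_congr rfl fun i _ => ?_
    rw [inner_sum]
    refine Finset.sum_congr rfl fun j _ => ?_
    rw [real_inner_smul_left, real_inner_smul_right, hgram, mul_assoc]
  have h1 : charFun (P.map fun ω => ∑ j, c j * Y j ω) 1 =
      Complex.exp (-‖∑ j, c j • a j‖ ^ 2 / 2) := by
    rw [hY, hnorm, charFun_gaussianReal]
    simp [neg_div, Real.coe_toNNReal _ (sq_nonneg ‖∑ j, c j • a j‖)]
  rw [← charFun_stdGaussian, charFun_apply, charFun_apply, integral_map (by fun_prop)
    (by fun_prop)] at h1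
  rw [charFun_apply, charFun_apply, integral_map (by fun_prop) (by fun_prop),
    integral_map (by fun_prop) (by fun_prop)]
  convert h1 using 5 with ω x
  · simp [PiLp.inner_apply]
  · rw [inner_sum, PiLp.inner_apply]
    push_cast
    refine Finset.sum_congr rfl fun j _ => ?_
    simp [real_inner_smul_right, real_inner_comm]

section FractionalBrownianMotion

variable {Ω : Type*} [MeasurableSpace Ω] {P : Measure Ω}

lemma memLp_two_of_map_eq_gaussianReal {Y : Ω → ℝ} (hm : Measurable Y) {v : NNReal}
    (h : P.map Y = gaussianReal 0 v) : MemLp Y 2 P := by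
  have := memLp_id_gaussianReal (μ := 0) (v := v) 2
  rw [← h] at this
  exact this.comp_of_map hm.aemeasurable

lemma integral_sq_of_map_eq_gaussianReal {Y : Ω → ℝ} (hm : Measurable Y) {v : NNReal}
    (h : P.map Y = gaussianReal 0 v) : ∫ ω, Y ω ^ 2 ∂P = v := by
  have h1 : ∫ y, y ^ 2 ∂(P.map Y) = v := by
    rw [h, ← variance_id_gaussianReal (μ := 0) (v := v), variance_eq_integral (by fun_prop)]
    simp
  rwa [integral_map hm.aemeasurable (by fun_prop)] at h1

variable {X : ℝ → Ω → ℝ} {H : ℝ}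

lemma covH_self (hH : 0 < H) (s : ℝ) : covH H s s = |s| ^ (2 * H) := by
  simp [covH, Real.zero_rpow (by positivity : 2 * H ≠ 0)]

lemma IsCenteredGaussianProcess.memLp_two {C : ℝ → ℝ → ℝ} (hX : IsCenteredGaussianProcess P X C)
    (s : ℝ) : MemLp (X s) 2 P := by
  have h := hX.2 1 (fun _ => s) (fun _ => 1)
  simp only [one_mul, Finset.univ_unique, Finset.sum_const, Finset.card_singleton, one_smul] at h
  exact memLp_two_of_map_eq_gaussianReal (hX.1 s) h

lemma IsCenteredGaussianProcess.integral_mul (hX : IsCenteredGaussianProcess P X (covH H))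
    (hH : 0 < H) (s t : ℝ) : ∫ ω, X s ω * X t ω ∂P = covH H s t := by
  have hsq : ∀ r, ∫ ω, X r ω ^ 2 ∂P = |r| ^ (2 * H) := by
    intro r
    have h := hX.2 1 (fun _ => r) (fun _ => 1)
    simp only [one_mul, Finset.univ_unique, Finset.sum_const, Finset.card_singleton, one_smul,
      covH_self hH] at h
    rw [integral_sq_of_map_eq_gaussianReal (hX.1 r) h, Real.coe_toNNReal _ (by positivity)]
  have hsub : ∫ ω, (X s ω - X t ω) ^ 2 ∂P = |s - t| ^ (2 * H) := by
    have h := hX.2 2 ![s, t] ![1, -1]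
    have hv : ∑ i, ∑ j, (![1, -1] : Fin 2 → ℝ) i * (![1, -1] : Fin 2 → ℝ) j *
        covH H (![s, t] i) (![s, t] j) = |s - t| ^ (2 * H) := by
      simp only [Fin.sum_univ_two, Matrix.cons_val_zero, Matrix.cons_val_one, covH_self hH]
      simp only [covH, abs_sub_comm t s]
      ring
    rw [hv] at h
    simp only [Fin.sum_univ_two, Matrix.cons_val_zero, Matrix.cons_val_one, one_mul, neg_mul,
      ← sub_eq_add_neg] at h
    rw [integral_sq_of_map_eq_gaussianReal (Y := fun ω => X s ω - X t ω)
      ((hX.1 s).sub (hX.1 t)) h, Real.coe_toNNReal _ (by positivity)]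
  have hprod : ∀ ω, X s ω * X t ω = (X s ω ^ 2 + X t ω ^ 2 - (X s ω - X t ω) ^ 2) / 2 :=
    fun ω => by ring
  have hs := (hX.memLp_two s).integrable_sq
  have ht := (hX.memLp_two t).integrable_sq
  have hst : Integrable (fun ω => (X s ω - X t ω) ^ 2) P :=
    ((hX.memLp_two s).sub (hX.memLp_two t)).integrable_sq
  have hadd : Integrable (fun ω => X s ω ^ 2 + X t ω ^ 2) P := hs.add ht
  simp_rw [hprod]
  rw [integral_div, integral_sub hadd hst, integral_add hs ht, hsq, hsq, hsub, covH]

/-- Covariance matrix of the increments of the process over `N` consecutive dyadic steps. -/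
def incrCov (H : ℝ) (n N : ℕ) : Matrix (Fin N) (Fin N) ℝ := fun j k =>
  ((2 : ℝ) ^ (-(n : ℝ) / 2)) ^ (2 * H) * rhoH H ((j : ℤ) - (k : ℤ))

lemma covH_increments (n j k : ℕ) :
    covH H (dyadicPt n (j + 1)) (dyadicPt n (k + 1)) - covH H (dyadicPt n (j + 1)) (dyadicPt n k) -
      covH H (dyadicPt n j) (dyadicPt n (k + 1)) + covH H (dyadicPt n j) (dyadicPt n k) =
    ((2 : ℝ) ^ (-(n : ℝ) / 2)) ^ (2 * H) * rhoH H ((j : ℤ) - (k : ℤ)) := by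
  set δ := (2 : ℝ) ^ (-(n : ℝ) / 2) with hδ
  have hδ0 : 0 ≤ δ := by positivity
  have h : ∀ x y : ℝ, |x * δ - y * δ| ^ (2 * H) = |x - y| ^ (2 * H) * δ ^ (2 * H) := by
    intro x y
    rw [← sub_mul, abs_mul, abs_of_nonneg hδ0, Real.mul_rpow (abs_nonneg _) hδ0]
  simp only [covH, dyadicPt, ← hδ, h, rhoH]
  push_cast
  rw [show (j : ℝ) + 1 - (k + 1) = j - k by ring, show (j : ℝ) + 1 - k = j - k + 1 by ring,
    show (j : ℝ) - (k + 1) = j - k - 1 by ring]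
  ring

lemma IsCenteredGaussianProcess.map_sum_Xincr (hX : IsCenteredGaussianProcess P X (covH H))
    (n N : ℕ) (c : Fin N → ℝ) :
    P.map (fun ω => ∑ j, c j * Xincr X n j ω) =
      gaussianReal 0 (Real.toNNReal (∑ i, ∑ j, c i * c j * incrCov H n N i j)) := by
  have h := hX.2 (N + N) (Fin.append (fun j => dyadicPt n (j + 1)) fun j => dyadicPt n j)
    (Fin.append c (-c))
  simp only [Fin.sum_univ_add, Fin.append_left, Fin.append_right, Pi.neg_apply] at h
  convert h using 3
  · rw [← Finset.sum_add_distrib]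
    exact Finset.sum_congr rfl fun j _ => by rw [Xincr]; ring
  · simp only [← Finset.sum_add_distrib]
    refine Finset.sum_congr rfl fun j _ => Finset.sum_congr rfl fun k _ => ?_
    rw [incrCov, ← covH_increments]
    ring

lemma IsCenteredGaussianProcess.integral_mul_Xincr
    (hX : IsCenteredGaussianProcess P X (covH H)) (hH : 0 < H) (n j k : ℕ) :
    ∫ ω, Xincr X n j ω * Xincr X n k ω ∂P =
      ((2 : ℝ) ^ (-(n : ℝ) / 2)) ^ (2 * H) * rhoH H ((j : ℤ) - (k : ℤ)) := by
  have hi : ∀ s t, Integrable (fun ω => X s ω * X t ω) P := fun s t =>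
    (hX.memLp_two s).integrable_mul (hX.memLp_two t)
  have he : ∀ ω, Xincr X n j ω * Xincr X n k ω =
      X (dyadicPt n (j + 1)) ω * X (dyadicPt n (k + 1)) ω -
      X (dyadicPt n (j + 1)) ω * X (dyadicPt n k) ω -
      X (dyadicPt n j) ω * X (dyadicPt n (k + 1)) ω +
      X (dyadicPt n j) ω * X (dyadicPt n k) ω := fun ω => by
    simp only [Xincr]
    ring
  have h2 : Integrable (fun ω => X (dyadicPt n (j + 1)) ω * X (dyadicPt n (k + 1)) ω -
      X (dyadicPt n (j + 1)) ω * X (dyadicPt n k) ω) P := (hi _ _).sub (hi _ _)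
  have h3 : Integrable (fun ω => X (dyadicPt n (j + 1)) ω * X (dyadicPt n (k + 1)) ω -
      X (dyadicPt n (j + 1)) ω * X (dyadicPt n k) ω -
      X (dyadicPt n j) ω * X (dyadicPt n (k + 1)) ω) P := h2.sub (hi _ _)
  simp_rw [he]
  rw [integral_add h3 (hi _ _), integral_sub h2 (hi _ _), integral_sub (hi _ _) (hi _ _),
    hX.integral_mul hH, hX.integral_mul hH, hX.integral_mul hH, hX.integral_mul hH,
    covH_increments]

lemma IsCenteredGaussianProcess.posSemidef_incrCov
    (hX : IsCenteredGaussianProcess P X (covH H)) (hH : 0 < H) (n N : ℕ) :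
    (incrCov H n N).PosSemidef := by
  have hmem : ∀ j : ℕ, MemLp (Xincr X n j) 2 P := fun j =>
    (hX.memLp_two _).sub (hX.memLp_two _)
  refine Matrix.PosSemidef.of_dotProduct_mulVec_nonneg ?_ fun c => ?_
  · ext j k
    simp only [Matrix.conjTranspose_apply, incrCov, star_trivial,
      ← hX.integral_mul_Xincr hH, mul_comm (Xincr X n (k : ℕ) _)]
  · have h : star c ⬝ᵥ (incrCov H n N).mulVec c = ∫ ω, (∑ j, c j * Xincr X n j ω) ^ 2 ∂P := by
      have he : ∀ ω, (∑ j, c j * Xincr X n j ω) ^ 2 =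
          ∑ j, ∑ k, c j * c k * (Xincr X n j ω * Xincr X n k ω) := fun ω => by
        rw [sq, Finset.sum_mul_sum]
        exact Finset.sum_congr rfl fun j _ => Finset.sum_congr rfl fun k _ => by ring
      have hi : ∀ j k : Fin N, Integrable (fun ω =>
          c j * c k * (Xincr X n j ω * Xincr X n k ω)) P := fun j k =>
        ((hmem j).integrable_mul (hmem k)).const_mul _
      simp_rw [he]
      rw [integral_finsetSum _ fun j _ => integrable_finsetSum _ fun k _ => hi j k]
      simp_rw [integral_finsetSum _ fun k _ => hi _ k, integral_const_mul,
        hX.integral_mul_Xincr hH, dotProduct, Matrix.mulVec, dotProduct, Finset.mul_sum]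
      exact Finset.sum_congr rfl fun j _ => Finset.sum_congr rfl fun k _ => by
        rw [incrCov, Pi.star_apply, star_trivial]
        ring
    rw [h]
    positivity

lemma rhoH_neg (k : ℤ) : rhoH H (-k) = rhoH H k := by
  simp only [rhoH, Int.cast_neg]
  rw [show -(k : ℝ) + 1 = -(k - 1) by ring, show -(k : ℝ) - 1 = -(k + 1) by ring, abs_neg,
    abs_neg, abs_neg]
  ring

lemma rhoH_zero (hH : 0 < H) : rhoH H 0 = 1 := by
  simp [rhoH, Real.zero_rpow (by positivity : 2 * H ≠ 0)]

lemma rhoH_mem_Icc (hH : 0 < H) (hH2 : H ≤ 1 / 2) {k : ℤ} (hk : k ≠ 0) :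
    rhoH H k ∈ Set.Icc (-(1 / 2)) 0 := by
  obtain ⟨m, hm⟩ : ∃ m : ℕ, rhoH H k = rhoH H ((m : ℤ) + 1) := by
    rcases Int.natAbs_eq k with h | h
    · exact ⟨k.natAbs - 1, by congr 1; omega⟩
    · exact ⟨k.natAbs - 1, by rw [← rhoH_neg k]; congr 1; omega⟩
  have hm0 : (0 : ℝ) ≤ m := m.cast_nonneg
  have hr : rhoH H ((m : ℤ) + 1) =
      (((m : ℝ) + 2) ^ (2 * H) + (m : ℝ) ^ (2 * H) - 2 * ((m : ℝ) + 1) ^ (2 * H)) / 2 := by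
    simp only [rhoH]
    push_cast
    rw [add_sub_cancel_right, abs_of_nonneg hm0, abs_of_nonneg (by positivity),
      abs_of_nonneg (by positivity), add_assoc (m : ℝ), one_add_one_eq_two]
  rw [hm, hr]
  constructor
  · have h1 : ((m : ℝ) + 1) ^ (2 * H) ≤ ((m : ℝ) + 2) ^ (2 * H) :=
      Real.rpow_le_rpow (by positivity) (by linarith) (by positivity)
    have h2 : ((m : ℝ) + 1) ^ (2 * H) ≤ (m : ℝ) ^ (2 * H) + 1 ^ (2 * H) :=
      Real.rpow_add_le_add_rpow hm0 zero_le_one (by positivity) (by linarith)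
    rw [Real.one_rpow] at h2
    linarith
  · have h := (Real.concaveOn_rpow (p := 2 * H) (by positivity) (by linarith)).2
      (x := (m : ℝ)) (y := (m : ℝ) + 2) hm0 (by simp only [Set.mem_Ici]; positivity)
      (by norm_num : (0 : ℝ) ≤ 1 / 2) (by norm_num : (0 : ℝ) ≤ 1 / 2) (by norm_num)
    simp only [smul_eq_mul] at h
    rw [show 1 / 2 * (m : ℝ) + 1 / 2 * (m + 2) = m + 1 by ring] at h
    linarith

lemma IsCenteredGaussianProcess.le_sum_incrCov_pow_three
    (hX : IsCenteredGaussianProcess P X (covH H)) (hH : 0 < H) (hH2 : H ≤ 1 / 2) (n N : ℕ) :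
    3 / 4 * (N * ((2 : ℝ) ^ (-(n : ℝ) / 2)) ^ (6 * H)) ≤ ∑ j, ∑ k, incrCov H n N j k ^ 3 := by
  set q := ((2 : ℝ) ^ (-(n : ℝ) / 2)) ^ (2 * H) with hq
  have hq0 : 0 < q := by positivity
  have hq3 : ((2 : ℝ) ^ (-(n : ℝ) / 2)) ^ (6 * H) = q ^ 3 := by
    rw [hq, ← Real.rpow_mul_natCast (by positivity)]
    congr 1
    push_cast
    ring
  have hpos : 0 ≤ ∑ j : Fin N, ∑ k : Fin N, incrCov H n N j k := by
    have h := (hX.posSemidef_incrCov hH n N).dotProduct_mulVec_nonneg fun _ => 1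
    simpa [dotProduct, Matrix.mulVec] using h
  have hle : ∀ j k : Fin N, q ^ 2 / 4 * incrCov H n N j k + (if j = k then 3 / 4 * q ^ 3 else 0) ≤
      incrCov H n N j k ^ 3 := by
    intro j k
    simp only [incrCov, ← hq]
    split_ifs with h
    · rw [h, sub_self, rhoH_zero hH]
      linarith
    · obtain ⟨h1, h2⟩ := rhoH_mem_Icc hH hH2 (k := (j : ℤ) - k) (by omega)
      set r := rhoH H ((j : ℤ) - k)
      have h3 : r / 4 ≤ r ^ 3 := by
        nlinarith [mul_nonneg (neg_nonneg.2 h2) (by nlinarith : 0 ≤ 1 / 4 - r ^ 2)]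
      have := mul_le_mul_of_nonneg_left h3 (pow_pos hq0 3).le
      linarith
  calc 3 / 4 * (N * ((2 : ℝ) ^ (-(n : ℝ) / 2)) ^ (6 * H))
      ≤ q ^ 2 / 4 * (∑ j : Fin N, ∑ k : Fin N, incrCov H n N j k) + 3 / 4 * (N * q ^ 3) := by
        rw [hq3]
        have : 0 ≤ q ^ 2 / 4 * (∑ j : Fin N, ∑ k : Fin N, incrCov H n N j k) := by positivity
        linarith
    _ = ∑ j : Fin N, ∑ k : Fin N,
          (q ^ 2 / 4 * incrCov H n N j k + (if j = k then 3 / 4 * q ^ 3 else 0)) := by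
        simp only [Finset.sum_add_distrib, Finset.mul_sum, Finset.sum_ite_eq, Finset.mem_univ,
          if_true, Finset.sum_const, Finset.card_univ, Fintype.card_fin, nsmul_eq_mul]
        ring
    _ ≤ _ := Finset.sum_le_sum fun j _ => Finset.sum_le_sum fun k _ => hle j k

lemma IsCenteredGaussianProcess.integral_cos_cubic_variation_le [IsProbabilityMeasure P]
    (hX : IsCenteredGaussianProcess P X (covH H)) (hH : 0 < H) (n N : ℕ) (s : ℝ) :
    1 - ∫ h, ∫ g, Real.exp (-((8 / √3 * s) ^ 2 / 2 * h ^ 2 *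
        ((∑ j, ∑ k, incrCov H n N j k ^ 3) * g ^ 2))) ∂(gaussianReal 0 1) ∂(gaussianReal 0 1) ≤
      16 * (1 - ∫ ω, Real.cos (s * ∑ j ∈ Finset.range N, Xincr X n j ω ^ 3) ∂P) := by
  have hm : ∀ j : ℕ, Measurable (Xincr X n j) := fun j => (hX.1 _).sub (hX.1 _)
  obtain ⟨m, a, hgram, hmap⟩ := exists_gram_map_eq_map_stdGaussian
    (Y := fun (j : Fin N) => Xincr X n j) (fun j => hm j) (hX.posSemidef_incrCov hH n N)
    (hX.map_sum_Xincr n N)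
  have h1 := one_sub_integral_cos_cubicForm_le a s
  have h2 := integral_cos_cubicForm_le a (8 / √3 * s)
  have h3 : ∫ ω, Real.cos (s * ∑ j ∈ Finset.range N, Xincr X n j ω ^ 3) ∂P =
      ∫ x, Real.cos (s * cubicForm a x x x) ∂(stdGaussian _) := by
    have h := congrArg (fun ν : Measure (EuclideanSpace ℝ (Fin N)) =>
      ∫ v, Real.cos (s * ∑ j, v j ^ 3) ∂ν) hmap
    simp only at h
    rw [integral_map (by fun_prop) (by fun_prop), integral_map (by fun_prop) (by fun_prop)] at h
    simp only [Finset.sum_range]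
    refine h.trans (integral_congr_ae (Eventually.of_forall fun x => ?_))
    simp only [cubicForm]
    congr 2
    exact Finset.sum_congr rfl fun j _ => by ring
  simp only [hgram] at h2
  rw [h3]
  linarith

end FractionalBrownianMotion

lemma tendsto_two_rpow_half : Tendsto (fun n : ℕ => (2 : ℝ) ^ ((n : ℝ) / 2)) atTop atTop :=
  (tendsto_rpow_atTop_of_base_gt_one 2 one_lt_two).comp
    (tendsto_natCast_atTop_atTop.atTop_div_const two_pos)

lemma two_rpow_neg_half (n : ℕ) : (2 : ℝ) ^ (-(n : ℝ) / 2) = ((2 : ℝ) ^ ((n : ℝ) / 2))⁻¹ := by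
  rw [neg_div, Real.rpow_neg zero_le_two]

lemma tendsto_dyadicPt_nSteps {t : ℝ} (ht : 0 < t) :
    Tendsto (fun n => dyadicPt n (nSteps n t)) atTop (nhds t) := by
  refine ((tendsto_nat_floor_mul_div_atTop ht.le).comp tendsto_two_rpow_half).congr fun n => ?_
  simp only [Function.comp, dyadicPt, nSteps, two_rpow_neg_half, mul_comm t]
  exact div_eq_mul_inv _ _

lemma tendsto_nSteps_mul_rpow {H t : ℝ} (hH : H < 1 / 6) (ht : 0 < t) :
    Tendsto (fun n => (nSteps n t : ℝ) * ((2 : ℝ) ^ (-(n : ℝ) / 2)) ^ (6 * H)) atTop atTop := by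
  have hexp : Tendsto (fun n : ℕ => ((2 : ℝ) ^ ((n : ℝ) / 2)) ^ (1 - 6 * H)) atTop atTop :=
    (tendsto_rpow_atTop (by linarith)).comp tendsto_two_rpow_half
  have h := (tendsto_dyadicPt_nSteps ht).pos_mul_atTop ht hexp
  refine h.congr fun n => ?_
  have hD : (0 : ℝ) < 2 ^ ((n : ℝ) / 2) := by positivity
  rw [dyadicPt, two_rpow_neg_half, Real.inv_rpow hD.le, Real.rpow_sub hD, Real.rpow_one]
  field_simp

lemma sum_midpoint_sq_mul_sub (x : ℕ → ℝ) (N : ℕ) :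
    3 * ∑ j ∈ Finset.range N, ((x (j + 1) + x j) / 2) ^ 2 * (x (j + 1) - x j) =
      x N ^ 3 - x 0 ^ 3 - 1 / 4 * ∑ j ∈ Finset.range N, (x (j + 1) - x j) ^ 3 := by
  rw [← Finset.sum_range_sub (fun j => x j ^ 3), Finset.mul_sum, Finset.mul_sum,
    ← Finset.sum_sub_distrib]
  exact Finset.sum_congr rfl fun j _ => by ring

lemma tendsto_integral_one_sub_cos_mul {α : Type*} [MeasurableSpace α] {ν : Measure α}
    [IsFiniteMeasure ν] {f : α → ℝ} (hf : Measurable f) :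
    Tendsto (fun s : ℝ => ∫ x, (1 - Real.cos (s * f x)) ∂ν) (nhds 0) (nhds 0) := by
  have h : Continuous fun s : ℝ => ∫ x, (1 - Real.cos (s * f x)) ∂ν := by
    refine continuous_of_dominated (bound := fun _ => 2) (fun s => by fun_prop)
      (fun s => Eventually.of_forall fun x => ?_) (integrable_const _)
      (Eventually.of_forall fun x => by fun_prop)
    rw [Real.norm_eq_abs, abs_le]
    constructor <;> linarith [Real.cos_le_one (s * f x), Real.neg_one_le_cos (s * f x)]
  simpa using h.tendsto 0

theorem no_ito_formula_low_hurst
    {Ω : Type*} [MeasurableSpace Ω] (P : Measure Ω) [IsProbabilityMeasure P]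
    (H : ℝ) (hH0 : 0 < H) (hH : H < 1 / 6)
    (X1 : ℝ → Ω → ℝ)
    (hX1 : IsCenteredGaussianProcess P X1 (covH H))
    (hc1 : ∀ ω, Continuous fun u => X1 u ω)
    (t : ℝ) (ht : 0 < t) :
    ¬ ∃ μ : Measure ℝ, IsProbabilityMeasure μ ∧
      ∀ g : ℝ → ℝ, Continuous g → (∃ M : ℝ, ∀ x, |g x| ≤ M) →
        Tendsto
          (fun n : ℕ => ∫ ω,
            g (3 * ∑ j ∈ Finset.range (nSteps n t),
              (((X1 (dyadicPt n (j + 1)) ω + X1 (dyadicPt n j) ω) / 2) ^ 2 *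
                Xincr X1 n j ω)) ∂P)
          atTop (nhds (∫ x, g x ∂μ)) := by
  rintro ⟨μ, hμ, hlim⟩
  set O : ℕ → Ω → ℝ := fun n ω => 3 * ∑ j ∈ Finset.range (nSteps n t),
    (((X1 (dyadicPt n (j + 1)) ω + X1 (dyadicPt n j) ω) / 2) ^ 2 * Xincr X1 n j ω) with hO
  set V : ℕ → Ω → ℝ := fun n ω => ∑ j ∈ Finset.range (nSteps n t), Xincr X1 n j ω ^ 3 with hV
  set Y : ℝ → Ω → ℝ := fun r ω => X1 r ω ^ 3 - X1 0 ω ^ 3 with hY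
  have hXm := hX1.1
  have hincr : ∀ n j, Measurable (Xincr X1 n j) := fun n j => (hXm _).sub (hXm _)
  have hOm : ∀ n, Measurable (O n) := fun n => by fun_prop
  have hVm : ∀ n, Measurable (V n) := fun n => by fun_prop
  have hYm : ∀ r, Measurable (Y r) := fun r => by fun_prop
  have hdecomp : ∀ n ω, V n ω = 4 * Y (dyadicPt n (nSteps n t)) ω + -(4 * O n ω) := by
    intro n ω
    have h := sum_midpoint_sq_mul_sub (fun j => X1 (dyadicPt n j) ω) (nSteps n t)
    simp only [hO, hV, hY, Xincr, h]
    simp only [dyadicPt, Nat.cast_zero, zero_mul]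
    ring
  have hi : ∀ f : Ω → ℝ, Measurable f → Integrable (fun ω => 1 - Real.cos (f ω)) P := fun f hf =>
    (integrable_const _).sub (integrable_cos_comp hf)
  have hOlim : ∀ s : ℝ, Tendsto (fun n => ∫ ω, (1 - Real.cos (s * O n ω)) ∂P) atTop
      (nhds (∫ x, (1 - Real.cos (s * x)) ∂μ)) := fun s =>
    hlim (fun x => 1 - Real.cos (s * x)) (by fun_prop) ⟨2, fun x => by
      rw [abs_le]
      constructor <;> linarith [Real.cos_le_one (s * x), Real.neg_one_le_cos (s * x)]⟩
  have hYlim : ∀ s : ℝ, Tendsto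
      (fun n => ∫ ω, (1 - Real.cos (s * Y (dyadicPt n (nSteps n t)) ω)) ∂P) atTop
      (nhds (∫ ω, (1 - Real.cos (s * Y t ω)) ∂P)) := by
    intro s
    refine tendsto_integral_of_dominated_convergence (fun _ => 2)
      (fun n => (hi _ (by fun_prop)).aestronglyMeasurable) (integrable_const _)
      (fun n => Eventually.of_forall fun ω => ?_) (Eventually.of_forall fun ω => ?_)
    · rw [Real.norm_eq_abs, abs_le]
      set x := s * Y (dyadicPt n (nSteps n t)) ω
      constructor <;> linarith [Real.cos_le_one x, Real.neg_one_le_cos x]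
    · have hc : Continuous fun r => 1 - Real.cos (s * Y r ω) := by
        have := hc1 ω
        fun_prop
      exact (hc.tendsto t).comp (tendsto_dyadicPt_nSteps ht)
  obtain ⟨s, hs, hs1, hs2⟩ : ∃ s : ℝ, 0 < s ∧ ∫ x, (1 - Real.cos (s * x)) ∂μ < 1 / 128 ∧
      ∫ ω, (1 - Real.cos (s * Y t ω)) ∂P < 1 / 128 := by
    have h1 := (tendsto_integral_one_sub_cos_mul (ν := μ) measurable_id).eventually_lt_const
      (by norm_num : (0 : ℝ) < 1 / 128)
    have h2 := (tendsto_integral_one_sub_cos_mul (ν := P) (hYm t)).eventually_lt_const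
      (by norm_num : (0 : ℝ) < 1 / 128)
    obtain ⟨s, hs, hs'⟩ := ((h1.and h2).filter_mono nhdsWithin_le_nhds |>.and
      (self_mem_nhdsWithin (s := Set.Ioi (0 : ℝ)))).exists
    exact ⟨s, hs', hs.1, hs.2⟩
  have hVle : ∀ᶠ n in atTop, 1 - ∫ ω, Real.cos (s / 4 * V n ω) ∂P < 1 / 32 := by
    filter_upwards [(hOlim s).eventually_lt_const hs1, (hYlim s).eventually_lt_const hs2]
      with n h1 h2
    have hle : ∫ ω, (1 - Real.cos (s / 4 * V n ω)) ∂P ≤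
        ∫ ω, (2 * (1 - Real.cos (s * Y (dyadicPt n (nSteps n t)) ω)) +
          2 * (1 - Real.cos (s * O n ω))) ∂P := by
      refine integral_mono (hi _ (by fun_prop))
        (((hi _ (by fun_prop)).const_mul 2).add ((hi _ (by fun_prop)).const_mul 2)) fun ω => ?_
      have h := one_sub_cos_add_le (s * Y (dyadicPt n (nSteps n t)) ω) (-(s * O n ω))
      rw [Real.cos_neg] at h
      have hV' : s / 4 * V n ω = s * Y (dyadicPt n (nSteps n t)) ω + -(s * O n ω) := by
        rw [hdecomp]
        ring
      simp only [hV']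
      exact h
    rw [integral_add ((hi _ (by fun_prop)).const_mul 2) ((hi _ (by fun_prop)).const_mul 2),
      integral_const_mul, integral_const_mul,
      integral_sub (integrable_const _) (integrable_cos_comp (by fun_prop))] at hle
    simp only [integral_const, probReal_univ, one_smul] at hle
    linarith
  have hS : Tendsto (fun n => ∑ j, ∑ k, incrCov H n (nSteps n t) j k ^ 3) atTop atTop :=
    tendsto_atTop_mono (fun n => hX1.le_sum_incrCov_pow_three hH0 (by linarith) n (nSteps n t))
      ((tendsto_nSteps_mul_rpow hH ht).const_mul_atTop (by norm_num))
  have hF := ((tendsto_integral_exp_neg_sq_mul_sq (u := 8 / √3 * (s / 4)) (by positivity)).comp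
    hS).eventually_lt_const (by norm_num : (0 : ℝ) < 1 / 2)
  obtain ⟨n, h1, h2⟩ := (hVle.and hF).exists
  have h3 := hX1.integral_cos_cubic_variation_le hH0 n (nSteps n t) (s / 4)
  simp only [Function.comp] at h2
  simp only [hV] at h1
  linarith

end
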